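/- Existence of a weight function for the interior problem (Lemma 3.2). Let B ⊂ ℝ^n and Ω be bounded domains with C^4 boundaries such that closure(Ω) ⊂ B. Then there exists a function φ of class C^4 on a neighborhood of closure(B) such that φ > 0 in B, φ = 0 on ∂B, and min over closure(B \ Ω) of |∇φ| > 0. -/

import Mathlib

open MeasureTheory Set
open scoped Topology RealInnerProductSpace

noncomputable section

/-- Euclidean space `ℝ^n`. -/
abbrev Eucl (n : ℕ) : Type := EuclideanSpace ℝ (Fin n)

variable {n : ℕ}

/-- `i`-th partial derivative `∂_i u`. -/
def pd (u : Eucl n → ℝ) (i : Fin n) (x : Eucl n) : ℝ :=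
  fderiv ℝ u x (EuclideanSpace.single i 1)

/-- Laplace–Beltrami operator
`Δ_g u = |g|^{-1/2} ∂_i (|g|^{1/2} g^{ij} ∂_j u)` (with `(g^{ij}) = (g_{ij})⁻¹`). -/
def LapBel (g : Eucl n → Matrix (Fin n) (Fin n) ℝ) (u : Eucl n → ℝ) (x : Eucl n) : ℝ :=
  (Real.sqrt (g x).det)⁻¹ *
    ∑ i, pd (fun y => Real.sqrt (g y).det * ∑ j, (g y)⁻¹ i j * pd u j y) i x

/-- `⟨∇_g w, ∇_g z⟩_g = g^{ij} ∂_i w ∂_j z`. -/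
def gInnerGrad (g : Eucl n → Matrix (Fin n) (Fin n) ℝ) (w z : Eucl n → ℝ) (x : Eucl n) : ℝ :=
  ∑ i, ∑ j, (g x)⁻¹ i j * pd w i x * pd z j x

/-- Uniform ellipticity: `g_{ij}(x) ξ^i ξ^j ≥ θ |ξ|²` for all `x, ξ`. -/
def UniformlyElliptic (g : Eucl n → Matrix (Fin n) (Fin n) ℝ) (θ : ℝ) : Prop :=
  ∀ (x : Eucl n) (ξ : Fin n → ℝ), θ * ∑ i, (ξ i) ^ 2 ≤ ∑ i, ∑ j, g x i j * ξ i * ξ j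

/-- Symmetric matrix-valued metric with `C³` entries having bounded derivatives up to order 3. -/
def MetricC3Bounded (g : Eucl n → Matrix (Fin n) (Fin n) ℝ) : Prop :=
  (∀ x, (g x).IsSymm) ∧ (∀ i j, ContDiff ℝ 3 fun x => g x i j) ∧
    ∃ M : ℝ, ∀ (i j : Fin n) (k : ℕ), k ≤ 3 → ∀ x,
      ‖iteratedFDeriv ℝ k (fun y => g y i j) x‖ ≤ M

/-- Symmetric matrix-valued metric with `C¹` entries. -/
def MetricC1 (g : Eucl n → Matrix (Fin n) (Fin n) ℝ) : Prop :=
  (∀ x, (g x).IsSymm) ∧ ∀ i j, ContDiff ℝ 1 fun x => g x i j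

/-- A bounded open set has `C⁴` boundary: near each boundary point there is a `C⁴` defining
function `ρ` with nonvanishing gradient, `D = {ρ < 0}` and `∂D = {ρ = 0}` locally. -/
def HasC4Boundary (D : Set (Eucl n)) : Prop :=
  ∀ x ∈ frontier D, ∃ (V : Set (Eucl n)) (ρ : Eucl n → ℝ),
    IsOpen V ∧ x ∈ V ∧ ContDiffOn ℝ 4 ρ V ∧ (∀ y ∈ V, gradient ρ y ≠ 0) ∧
    D ∩ V = {y | y ∈ V ∧ ρ y < 0} ∧ frontier D ∩ V = {y | y ∈ V ∧ ρ y = 0}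

/-- `ν` is the outward unit normal field of `D` on `∂D`: `ν = ∇ρ/|∇ρ|` for local `C⁴`
defining functions `ρ`. -/
def IsOutwardNormalField (D : Set (Eucl n)) (ν : Eucl n → Eucl n) : Prop :=
  ∀ x ∈ frontier D, ∃ (V : Set (Eucl n)) (ρ : Eucl n → ℝ),
    IsOpen V ∧ x ∈ V ∧ ContDiffOn ℝ 4 ρ V ∧ (∀ y ∈ V, gradient ρ y ≠ 0) ∧
    D ∩ V = {y | y ∈ V ∧ ρ y < 0} ∧ frontier D ∩ V = {y | y ∈ V ∧ ρ y = 0} ∧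
    ν x = ‖gradient ρ x‖⁻¹ • gradient ρ x

/-- Normal derivative `∂_ν w = ∇w · ν`. -/
def normalDeriv (ν : Eucl n → Eucl n) (w : Eucl n → ℝ) (x : Eucl n) : ℝ :=
  ⟪gradient w x, ν x⟫

/-- Tangential gradient `∇_τ w = ∇w − (∂_ν w) ν`. -/
def tangGrad (ν : Eucl n → Eucl n) (w : Eucl n → ℝ) (x : Eucl n) : Eucl n :=
  gradient w x - (normalDeriv ν w x) • ν x

/-- `g`-normal derivative `∂_{ν_g} w = g^{ij} ν_i ∂_j w / √(g^{kℓ} ν_k ν_ℓ)`. -/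
def gNormalDeriv (g : Eucl n → Matrix (Fin n) (Fin n) ℝ) (ν : Eucl n → Eucl n)
    (w : Eucl n → ℝ) (x : Eucl n) : ℝ :=
  (∑ i, ∑ j, (g x)⁻¹ i j * ν x i * pd w j x) /
    Real.sqrt (∑ k, ∑ l, (g x)⁻¹ k l * ν x k * ν x l)


/-- C⁴ diffeomorphisms of Euclidean space which are the identity off `A`. -/
def IsDf (A : Set (Eucl n)) (G : Eucl n ≃ Eucl n) : Prop :=
  ContDiff ℝ 4 G ∧ ContDiff ℝ 4 G.symm ∧ ∀ x, x ∉ A → G x = x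

lemma IsDf.symm {A : Set (Eucl n)} {G : Eucl n ≃ Eucl n} (h : IsDf A G) : IsDf A G.symm :=
  ⟨h.2.1, h.1, fun x hx => by rw [Equiv.symm_apply_eq]; exact (h.2.2 x hx).symm⟩

lemma IsDf.trans {A : Set (Eucl n)} {G H : Eucl n ≃ Eucl n} (h : IsDf A G) (h' : IsDf A H) :
    IsDf A (G.trans H) :=
  ⟨h'.1.comp h.1, h.2.1.comp h'.2.1, fun x hx => by
    simp [h.2.2 x hx, h'.2.2 x hx]⟩

lemma IsDf.mono {A A' : Set (Eucl n)} {G : Eucl n ≃ Eucl n} (h : IsDf A G) (hA : A ⊆ A') :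
    IsDf A' G :=
  ⟨h.1, h.2.1, fun x hx => h.2.2 x fun h => hx (hA h)⟩

lemma isDf_refl (A : Set (Eucl n)) : IsDf A (Equiv.refl _) :=
  ⟨contDiff_id, contDiff_id, fun _ _ => rfl⟩

lemma IsDf.mem {A : Set (Eucl n)} {G : Eucl n ≃ Eucl n} (h : IsDf A G) {x : Eucl n}
    (hx : x ∈ A) : G x ∈ A := by
  by_contra hc
  have := h.2.2 _ hc
  rw [G.apply_eq_iff_eq] at this
  rw [this] at hc
  exact hc hx

lemma exists_df_local {A : Set (Eucl n)} (hA : IsOpen A) {x : Eucl n} (hx : x ∈ A) :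
    ∃ r > 0, ∀ y ∈ Metric.ball x r, ∃ G, IsDf A G ∧ G x = y := by
  obtain ⟨R, hR, hRA⟩ := Metric.isOpen_iff.1 hA x hx
  let b : ContDiffBump x := ⟨R / 2, R, by positivity, by linarith⟩
  have hbC : ContDiff ℝ 4 b := b.contDiff
  obtain ⟨C, hC⟩ := hbC.lipschitzWith_of_hasCompactSupport b.hasCompactSupport (by norm_num)
  refine ⟨1 / (2 * (C + 1)), by positivity, fun y hy => ?_⟩
  set v := y - x with hv
  have hvn : C * ‖v‖ ≤ 1 / 2 := by
    rw [Metric.mem_ball, dist_eq_norm, lt_div_iff₀ (by positivity)] at hy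
    nlinarith [norm_nonneg v]
  let f : Eucl n → Eucl n := fun z => z + b z • v
  have hfC : ContDiff ℝ 4 f := contDiff_id.add (hbC.smul contDiff_const)
  have hap : ApproximatesLinearOn f
      ((ContinuousLinearEquiv.refl ℝ (Eucl n) : Eucl n ≃L[ℝ] Eucl n) : Eucl n →L[ℝ] Eucl n)
      univ (1 / 2) := by
    intro z _ w _
    have h1 : f z - f w - ((ContinuousLinearEquiv.refl ℝ (Eucl n) : Eucl n ≃L[ℝ] Eucl n) :
        Eucl n →L[ℝ] Eucl n) (z - w) = (b z - b w) • v := by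
      simp [f, sub_smul]; abel
    rw [h1, norm_smul]
    have h2 := hC.norm_sub_le z w
    have h3 : ‖b z - b w‖ * ‖v‖ ≤ (C * ‖z - w‖) * ‖v‖ := by gcongr
    have h4 : (C * ‖v‖) * ‖z - w‖ ≤ 1 / 2 * ‖z - w‖ := by gcongr
    push_cast
    linarith
  have hc : Subsingleton (Eucl n) ∨ (1 / 2 : NNReal) <
      ‖((ContinuousLinearEquiv.refl ℝ (Eucl n)).symm : Eucl n →L[ℝ] Eucl n)‖₊⁻¹ := by
    rcases subsingleton_or_nontrivial (Eucl n) with h | h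
    · exact Or.inl h
    · right
      have : ‖((ContinuousLinearEquiv.refl ℝ (Eucl n)).symm : Eucl n →L[ℝ] Eucl n)‖₊ = 1 := by
        apply NNReal.eq
        simpa using ContinuousLinearMap.norm_id (𝕜 := ℝ) (E := Eucl n)
      rw [this, inv_one]
      exact NNReal.half_lt_self one_ne_zero
  let F := hap.toHomeomorph f hc
  have hFf : ∀ z, F z = f z := fun z => rfl
  have hder : ∀ z, HasFDerivAt f
      (ContinuousLinearMap.id ℝ (Eucl n) + (fderiv ℝ b z).smulRight v) z := fun z =>
    (hasFDerivAt_id z).add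
      (((hbC.differentiable (by norm_num)) z).hasFDerivAt.smul_const v)
  have hinj : ∀ z, Function.Injective
      (ContinuousLinearMap.id ℝ (Eucl n) + (fderiv ℝ b z).smulRight v) := by
    intro z
    rw [injective_iff_map_eq_zero]
    intro w hw
    have h1 : w = -((fderiv ℝ b z w) • v) := by
      simpa [eq_neg_iff_add_eq_zero] using hw
    have h2 : ‖fderiv ℝ b z w‖ ≤ C * ‖w‖ :=
      (fderiv ℝ b z).le_of_opNorm_le (norm_fderiv_le_of_lipschitz ℝ hC) w
    have h3 : ‖w‖ = ‖fderiv ℝ b z w‖ * ‖v‖ := by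
      conv_lhs => rw [h1, norm_neg, norm_smul]
    have h4 : ‖fderiv ℝ b z w‖ * ‖v‖ ≤ (C * ‖w‖) * ‖v‖ := by gcongr
    have h5 : (C * ‖v‖) * ‖w‖ ≤ 1 / 2 * ‖w‖ := by gcongr
    have : ‖w‖ ≤ 0 := by linarith
    exact norm_le_zero_iff.1 this
  have hsymm : ContDiff ℝ 4 F.symm :=
    F.contDiff_symm (f₀' := fun z =>
      (LinearEquiv.ofInjectiveEndo _ (hinj z)).toContinuousLinearEquiv)
      (fun z => by
        have he : ((LinearEquiv.ofInjectiveEndo _ (hinj z)).toContinuousLinearEquiv :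
            Eucl n →L[ℝ] Eucl n) =
            ContinuousLinearMap.id ℝ (Eucl n) + (fderiv ℝ b z).smulRight v := by
          ext1 w; rfl
        rw [he]
        exact hder z) hfC
  refine ⟨F.toEquiv, ⟨hfC, hsymm, fun z hz => ?_⟩, ?_⟩
  · change z + b z • v = z
    have : b z = 0 := by
      apply b.zero_of_le_dist
      by_contra h
      exact hz (hRA (Metric.mem_ball.2 (not_le.1 h)))
    simp [this]
  · change x + b x • v = y
    have : b x = 1 := b.one_of_mem_closedBall (Metric.mem_closedBall_self (by positivity))
    simp [this, hv]

lemma exists_df_finite {B Ω : Set (Eucl n)} (hB : IsOpen B) (hBc : IsPreconnected B)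
    (hΩ : IsOpen Ω) (hne : Ω.Nonempty) (hΩB : Ω ⊆ B) {S : Set (Eucl n)} (hS : S.Finite) :
    S ⊆ B → ∃ G, IsDf B G ∧ ∀ s ∈ S, G s ∈ Ω := by
  induction S, hS using Set.Finite.induction_on with
  | empty => intro _; exact ⟨_, isDf_refl B, by simp⟩
  | @insert p S hp hS ih =>
    intro hSB
    obtain ⟨G, hG, hGS⟩ := ih fun s hs => hSB (mem_insert_of_mem _ hs)
    by_cases hq : G p ∈ Ω
    · refine ⟨G, hG, ?_⟩
      rintro s (rfl | hs)
      · exact hq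
      · exact hGS s hs
    set A := B \ (G '' S) with hAdef
    have hA : IsOpen A := hB.sdiff (hS.image G).isClosed
    have hTΩ : G '' S ⊆ Ω := by rintro _ ⟨s, hs, rfl⟩; exact hGS s hs
    have hqA : G p ∈ A := ⟨hG.mem (hSB (mem_insert _ _)), fun h => hq (hTΩ h)⟩
    suffices h : ∃ H, IsDf A H ∧ H (G p) ∈ Ω by
      obtain ⟨H, hH, hHq⟩ := h
      refine ⟨G.trans H, hG.trans (hH.mono diff_subset), ?_⟩
      rintro s (rfl | hs)
      · exact hHq
      · have : H (G s) = G s := hH.2.2 _ fun h => h.2 ⟨s, hs, rfl⟩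
        simpa [this] using hGS s hs
    by_contra! hcon
    set C := {z | ∃ H, IsDf A H ∧ H (G p) = z} with hC
    have hCA : C ⊆ A := by rintro _ ⟨H, hH, rfl⟩; exact hH.mem hqA
    have hCΩ : ∀ z ∈ C, z ∉ Ω := by rintro _ ⟨H, hH, rfl⟩; exact hcon H hH
    have hCo : IsOpen C := by
      rw [Metric.isOpen_iff]
      rintro z hz
      obtain ⟨r, hr, hloc⟩ := exists_df_local hA (hCA hz)
      refine ⟨r, hr, fun y hy => ?_⟩
      obtain ⟨K, hK, hKz⟩ := hloc y hy
      obtain ⟨H, hH, hHz⟩ := hz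
      exact ⟨H.trans K, hH.trans hK, by simp [hHz, hKz]⟩
    have hcl : ∀ z ∈ B, z ∈ closure C → z ∈ C := by
      intro z hzB hz
      have hzΩ : z ∉ Ω := by
        intro h
        obtain ⟨w, hw1, hw2⟩ := mem_closure_iff.1 hz Ω hΩ h
        exact hCΩ w hw2 hw1
      have hzA : z ∈ A := ⟨hzB, fun h => hzΩ (hTΩ h)⟩
      obtain ⟨r, hr, hloc⟩ := exists_df_local hA hzA
      obtain ⟨w, hw1, hw2⟩ := mem_closure_iff.1 hz _ Metric.isOpen_ball (Metric.mem_ball_self hr)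
      obtain ⟨K, hK, hKz⟩ := hloc w hw1
      obtain ⟨H, hH, hHz⟩ := hw2
      refine ⟨H.trans K.symm, hH.trans hK.symm, ?_⟩
      simp [hHz, ← hKz]
    have hBC : B ⊆ C := hBc.subset_of_closure_inter_subset hCo
      ⟨G p, hqA.1, ⟨_, isDf_refl A, rfl⟩⟩ (fun z hz => hcl z hz.2 hz.1)
    obtain ⟨o, ho⟩ := hne
    exact hCΩ o (hBC (hΩB ho)) ho

/-- One-sided derivative test along an entering direction. -/
lemma fderiv_nonneg_of_enter {B : Set (Eucl n)} {f : Eucl n → ℝ} (hf : ContDiff ℝ 4 f)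
    (hpos : ∀ x ∈ B, 0 ≤ f x) {x v : Eucl n} (hx : f x = 0)
    (hv : ∀ᶠ t : ℝ in 𝓝[>] 0, x + t • v ∈ B) : 0 ≤ fderiv ℝ f x v := by
  have h1 : HasFDerivAt f (fderiv ℝ f x) x := (hf.differentiable (by norm_num) x).hasFDerivAt
  have h2 := (h1.hasLineDerivAt v).tendsto_slope_zero_right
  refine ge_of_tendsto h2 ?_
  filter_upwards [hv, self_mem_nhdsWithin] with t ht ht0
  have := hpos _ ht
  have ht0 : 0 < t := ht0
  rw [hx, sub_zero, smul_eq_mul]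
  positivity

lemma exists_defining {B : Set (Eucl n)} (hB : IsOpen B) (hBb : Bornology.IsBounded B)
    (hC4 : HasC4Boundary B) :
    ∃ ψ : Eucl n → ℝ, ContDiff ℝ 4 ψ ∧ (∀ x ∈ B, 0 < ψ x) ∧ (∀ x ∈ frontier B, ψ x = 0) ∧
      ∀ x ∈ frontier B, fderiv ℝ ψ x ≠ 0 := by
  have hK : IsCompact (frontier B) :=
    Metric.isCompact_of_isClosed_isBounded isClosed_frontier
      (hBb.closure.subset frontier_subset_closure)
  have key : ∃ f : Eucl n → ℝ, ContDiff ℝ 4 f ∧ (∀ x ∈ B, 0 ≤ f x) ∧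
      (∀ x ∈ frontier B, f x = 0) ∧ ∀ x ∈ frontier B, x ∈ frontier B → ∃ v, 0 < fderiv ℝ f x v ∧
        ∀ᶠ t : ℝ in 𝓝[>] 0, x + t • v ∈ B := by
    refine hK.induction_on (p := fun S => ∃ f : Eucl n → ℝ, ContDiff ℝ 4 f ∧ (∀ x ∈ B, 0 ≤ f x) ∧
      (∀ x ∈ frontier B, f x = 0) ∧ ∀ x ∈ S, x ∈ frontier B → ∃ v, 0 < fderiv ℝ f x v ∧
        ∀ᶠ t : ℝ in 𝓝[>] 0, x + t • v ∈ B) ?_ ?_ ?_ ?_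
    · exact ⟨0, contDiff_const, by simp, by simp, by simp⟩
    · rintro s t hst ⟨f, h1, h2, h3, h4⟩
      exact ⟨f, h1, h2, h3, fun x hx => h4 x (hst hx)⟩
    · rintro s t ⟨f, h1, h2, h3, h4⟩ ⟨g, k1, k2, k3, k4⟩
      refine ⟨f + g, h1.add k1, fun x hx => add_nonneg (h2 x hx) (k2 x hx),
        fun x hx => by simp [h3 x hx, k3 x hx], ?_⟩
      intro x hx hxB
      have hadd : fderiv ℝ (f + g) x = fderiv ℝ f x + fderiv ℝ g x :=
        fderiv_add (h1.differentiable (by norm_num) x) (k1.differentiable (by norm_num) x)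
      rcases hx with hx | hx
      · obtain ⟨v, hv, hv'⟩ := h4 x hx hxB
        refine ⟨v, ?_, hv'⟩
        have := fderiv_nonneg_of_enter k1 k2 (k3 x hxB) hv'
        rw [hadd]; simp only [ContinuousLinearMap.add_apply]; linarith
      · obtain ⟨v, hv, hv'⟩ := k4 x hx hxB
        refine ⟨v, ?_, hv'⟩
        have := fderiv_nonneg_of_enter h1 h2 (h3 x hxB) hv'
        rw [hadd]; simp only [ContinuousLinearMap.add_apply]; linarith
    · intro x hx
      obtain ⟨V, ρ, hV, hxV, hρ, hgr, hin, hfr⟩ := hC4 x hx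
      obtain ⟨R, hR, hRV⟩ := Metric.isOpen_iff.1 hV x hxV
      let b : ContDiffBump x := ⟨R / 4, R / 2, by positivity, by linarith⟩
      have hsupp : tsupport b ⊆ V := by
        rw [b.tsupport_eq]
        exact (Metric.closedBall_subset_ball (by change R / 2 < R; linarith)).trans hRV
      have hb0 : ∀ y, y ∉ V → b y = 0 := fun y hy =>
        image_eq_zero_of_notMem_tsupport fun h => hy (hsupp h)
      refine ⟨Metric.ball x (R / 4),
        mem_nhdsWithin_of_mem_nhds (Metric.ball_mem_nhds _ (by positivity)),
        fun y => b y * (-ρ y), ?_, ?_, ?_, ?_⟩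
      · rw [contDiff_iff_contDiffAt]
        intro y
        by_cases hy : y ∈ V
        · exact b.contDiffAt.mul ((hρ.contDiffAt (hV.mem_nhds hy)).neg)
        · have h0 : ∀ᶠ z in 𝓝 y, b z = 0 := by
            filter_upwards [(isClosed_tsupport b).isOpen_compl.mem_nhds fun h => hy (hsupp h)]
              with z hz
            exact image_eq_zero_of_notMem_tsupport hz
          refine (contDiffAt_const (c := (0 : ℝ))).congr_of_eventuallyEq ?_
          filter_upwards [h0] with z hz
          simp [hz]
      · intro y hy
        by_cases hyV : y ∈ V
        · have : y ∈ {y | y ∈ V ∧ ρ y < 0} := hin ▸ ⟨hy, hyV⟩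
          exact mul_nonneg b.nonneg (by linarith [this.2])
        · simp [hb0 y hyV]
      · intro y hy
        by_cases hyV : y ∈ V
        · have : y ∈ {y | y ∈ V ∧ ρ y = 0} := hfr ▸ ⟨hy, hyV⟩
          simp [this.2]
        · simp [hb0 y hyV]
      · intro y hy hyB
        have hyV : y ∈ V := hRV (Metric.ball_subset_ball (by linarith) hy)
        have hρy : ρ y = 0 := by
          have : y ∈ {y | y ∈ V ∧ ρ y = 0} := hfr ▸ ⟨hyB, hyV⟩
          exact this.2
        have hd : DifferentiableAt ℝ ρ y :=
          (hρ.contDiffAt (hV.mem_nhds hyV)).differentiableAt (by norm_num)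
        have heq : (fun y => b y * (-ρ y)) =ᶠ[𝓝 y] fun z => -ρ z := by
          filter_upwards [b.eventuallyEq_one_of_mem_ball hy] with z hz
          simp [hz]
        have hfd : fderiv ℝ (fun y => b y * (-ρ y)) y = -fderiv ℝ ρ y := by
          rw [heq.fderiv_eq, fderiv_fun_neg]
        have hneg : fderiv ℝ ρ y (-gradient ρ y) < 0 := by
          have : fderiv ℝ ρ y (gradient ρ y) = ⟪gradient ρ y, gradient ρ y⟫ := by
            rw [inner_gradient_left]
          rw [map_neg, this, real_inner_self_eq_norm_sq]
          have := norm_pos_iff.2 (hgr y hyV)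
          have : 0 < ‖gradient ρ y‖ ^ 2 := by positivity
          linarith
        refine ⟨-gradient ρ y, ?_, ?_⟩
        · rw [hfd, ContinuousLinearMap.neg_apply]; linarith
        · have h2 := (hd.hasFDerivAt.hasLineDerivAt (-gradient ρ y)).tendsto_slope_zero_right
          have hVt : ∀ᶠ t : ℝ in 𝓝[>] 0, y + t • (-gradient ρ y) ∈ V := by
            have hc : Filter.Tendsto (fun t : ℝ => y + t • (-gradient ρ y)) (𝓝 0) (𝓝 y) := by
              have : Continuous (fun t : ℝ => y + t • (-gradient ρ y)) := by fun_prop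
              simpa using this.tendsto 0
            exact (hc.eventually (hV.mem_nhds hyV)).filter_mono nhdsWithin_le_nhds
          filter_upwards [h2.eventually (gt_mem_nhds hneg), hVt, self_mem_nhdsWithin]
            with t ht htV ht0
          have ht0 : 0 < t := ht0
          rw [hρy, sub_zero, smul_eq_mul] at ht
          have hlt : ρ (y + t • (-gradient ρ y)) < 0 := by
            by_contra! h
            have : 0 ≤ t⁻¹ * ρ (y + t • (-gradient ρ y)) := by positivity
            linarith
          have : y + t • (-gradient ρ y) ∈ B ∩ V := hin ▸ ⟨htV, hlt⟩
          exact this.1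
  obtain ⟨f, h1, h2, h3, h4⟩ := key
  obtain ⟨χ, hχs, hχd, hχr⟩ := hB.exists_contDiff_support_eq (n := 4)
  have hχd : ContDiff ℝ 4 χ := hχd
  have hχ0 : ∀ x, 0 ≤ χ x := fun x => (hχr ⟨x, rfl⟩).1
  have hχB : ∀ x ∈ B, 0 < χ x := fun x hx => by
    refine lt_of_le_of_ne (hχ0 x) (Ne.symm ?_)
    rw [← hχs] at hx
    exact hx
  have hχf : ∀ x ∈ frontier B, χ x = 0 := fun x hx => by
    by_contra h
    have : x ∈ B := hχs ▸ h
    rw [hB.frontier_eq] at hx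
    exact hx.2 this
  refine ⟨f + χ, h1.add hχd, fun x hx => add_pos_of_nonneg_of_pos (h2 x hx) (hχB x hx),
    fun x hx => by simp [h3 x hx, hχf x hx], fun x hx h0 => ?_⟩
  obtain ⟨v, hv, hv'⟩ := h4 x hx hx
  have := fderiv_nonneg_of_enter hχd (fun x _ => hχ0 x) (hχf x hx) hv'
  have hadd : fderiv ℝ (f + χ) x = fderiv ℝ f x + fderiv ℝ χ x :=
    fderiv_add (h1.differentiable (by norm_num) x) (hχd.differentiable (by norm_num) x)
  rw [h0] at hadd
  have := congrArg (fun L => L v) hadd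
  simp only [ContinuousLinearMap.add_apply, ContinuousLinearMap.zero_apply] at this
  linarith

/-- A defining function with finitely many critical points. -/
lemma exists_defining_finite {B : Set (Eucl n)} (hB : IsOpen B) (hBb : Bornology.IsBounded B)
    (hC4 : HasC4Boundary B) :
    ∃ ψ : Eucl n → ℝ, ContDiff ℝ 4 ψ ∧ (∀ x ∈ B, 0 < ψ x) ∧ (∀ x ∈ frontier B, ψ x = 0) ∧
      {x | x ∈ closure B ∧ gradient ψ x = 0}.Finite ∧
      {x | x ∈ closure B ∧ gradient ψ x = 0} ⊆ B := by
  obtain ⟨ψ, hψ, hpos, hzero, hfr⟩ := exists_defining hB hBb hC4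
  have hgC : ContDiff ℝ 3 (gradient ψ) :=
    (InnerProductSpace.toDual ℝ (Eucl n)).symm.contDiff.comp
      (hψ.fderiv_right (m := 3) (by norm_num))
  let g : Eucl n → Eucl n := fun x => (ψ x)⁻¹ • gradient ψ x
  have hgd : ∀ x ∈ B, DifferentiableAt ℝ g x := fun x hx =>
    ((hψ.differentiable (by norm_num) x).inv (hpos x hx).ne').smul
      (hgC.differentiable (by norm_num) x)
  have hsard : volume (g '' {x | x ∈ B ∧ (fderiv ℝ g x).det = 0}) = 0 :=
    addHaar_image_eq_zero_of_det_fderivWithin_eq_zero volume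
      (fun x hx => (hgd x hx.1).hasFDerivAt.hasFDerivWithinAt) (fun x hx => hx.2)
  obtain ⟨a, ha⟩ : ∃ a, a ∉ g '' {x | x ∈ B ∧ (fderiv ℝ g x).det = 0} := by
    by_contra! h
    rw [eq_univ_of_forall h] at hsard
    exact (isOpen_univ.measure_pos volume univ_nonempty).ne' hsard
  let ψ' : Eucl n → ℝ := fun x => ψ x * Real.exp (-⟪a, x⟫)
  have heC : ContDiff ℝ 4 fun x : Eucl n => Real.exp (-⟪a, x⟫) :=
    ((contDiff_const.inner ℝ contDiff_id).neg).exp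
  have hψ' : ContDiff ℝ 4 ψ' := hψ.mul heC
  have hgrad : ∀ x, gradient ψ' x = Real.exp (-⟪a, x⟫) • (gradient ψ x - ψ x • a) := by
    intro x
    have h1 : HasFDerivAt (fun x : Eucl n => ⟪a, x⟫) (innerSL ℝ a) x :=
      (innerSL ℝ a).hasFDerivAt
    have h2 : HasFDerivAt ψ' (ψ x • Real.exp (-⟪a, x⟫) • -(innerSL ℝ) a +
        Real.exp (-⟪a, x⟫) • fderiv ℝ ψ x) x :=
      ((hψ.differentiable (by norm_num) x).hasFDerivAt).mul h1.neg.exp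
    refine ext_inner_right ℝ fun w => ?_
    rw [inner_gradient_left, h2.fderiv,
      inner_smul_left, inner_sub_left, inner_smul_left,
      inner_gradient_left]
    simp
    ring
  have hcr : ∀ x, gradient ψ' x = 0 ↔ gradient ψ x = ψ x • a := by
    intro x
    rw [hgrad, smul_eq_zero, sub_eq_zero]
    simp [Real.exp_ne_zero]
  have hsub : {x | x ∈ closure B ∧ gradient ψ' x = 0} ⊆ B := by
    rintro x ⟨hx, hx0⟩
    by_contra hxB
    have hxf : x ∈ frontier B := by rw [hB.frontier_eq]; exact ⟨hx, hxB⟩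
    rw [hcr, hzero x hxf, zero_smul] at hx0
    apply hfr x hxf
    rw [gradient, map_eq_zero_iff _ (LinearIsometryEquiv.injective _)] at hx0
    exact hx0
  have hgC' : Continuous (gradient ψ') :=
    (InnerProductSpace.toDual ℝ (Eucl n)).symm.continuous.comp
      (hψ'.continuous_fderiv (by norm_num))
  refine ⟨ψ', hψ', fun x hx => mul_pos (hpos x hx) (Real.exp_pos _),
    fun x hx => by simp [ψ', hzero x hx], ?_, hsub⟩
  have hcomp : IsCompact {x | x ∈ closure B ∧ gradient ψ' x = 0} :=
    hBb.isCompact_closure.inter_right (isClosed_singleton.preimage hgC')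
  by_contra hinf
  obtain ⟨z, hz, hne⟩ := exists_nhds_ne_inf_principal_neBot hcomp hinf
  have hgB : ∀ x ∈ {x | x ∈ closure B ∧ gradient ψ' x = 0}, g x = a := by
    intro x hx
    have := (hcr x).1 hx.2
    change (ψ x)⁻¹ • gradient ψ x = a
    rw [this, smul_smul, inv_mul_cancel₀ (hpos x (hsub hx)).ne', one_smul]
  have hdet : (fderiv ℝ g z).det ≠ 0 := fun h => ha ⟨z, ⟨hsub hz, h⟩, hgB z hz⟩
  have hev : ∀ᶠ w in 𝓝[≠] z, g w ≠ a :=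
    (hgd z (hsub hz)).hasFDerivAt.eventually_ne
      ⟨_, ((fderiv ℝ g z).toContinuousLinearEquivOfDetNeZero hdet).antilipschitz⟩
  have : ∀ᶠ w in 𝓝[≠] z ⊓ Filter.principal {x | x ∈ closure B ∧ gradient ψ' x = 0}, False := by
    filter_upwards [hev.filter_mono inf_le_left, Filter.mem_inf_of_right (Filter.mem_principal_self _)]
      with w hw1 hw2
    exact hw1 (hgB w hw2)
  exact (this.exists).elim fun _ h => h

/-- **Existence of a weight function for the interior problem (Lemma 3.2).** -/
theorem exists_weight_function_interior
    (n : ℕ) (hn : 2 ≤ n)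
    (B Ω : Set (Eucl n))
    (hBop : IsOpen B) (hBconn : IsConnected B) (hBbdd : Bornology.IsBounded B)
    (hBC4 : HasC4Boundary B)
    (hΩop : IsOpen Ω) (hΩconn : IsConnected Ω) (hΩbdd : Bornology.IsBounded Ω)
    (hΩC4 : HasC4Boundary Ω)
    (hΩB : closure Ω ⊆ B) :
    ∃ (W : Set (Eucl n)) (φ : Eucl n → ℝ),
      IsOpen W ∧ closure B ⊆ W ∧ ContDiffOn ℝ 4 φ W ∧
      (∀ x ∈ B, 0 < φ x) ∧
      (∀ x ∈ frontier B, φ x = 0) ∧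
      ∃ δ > (0 : ℝ), ∀ x ∈ closure (B \ Ω), δ ≤ ‖gradient φ x‖ := by
  obtain ⟨ψ, hψ, hpos, hzero, hfin, hsub⟩ := exists_defining_finite hBop hBbdd hBC4
  obtain ⟨G, hG, hGS⟩ := exists_df_finite hBop hBconn.isPreconnected hΩop hΩconn.nonempty
    (subset_closure.trans hΩB) hfin hsub
  have hφ : ContDiff ℝ 4 (ψ ∘ G.symm) := hψ.comp hG.2.1
  have hfrx : ∀ x ∈ frontier B, x ∉ B := fun x hx => by
    rw [hBop.frontier_eq] at hx; exact hx.2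
  have hcl : ∀ x ∈ closure B, G.symm x ∈ closure B := by
    intro x hx
    by_cases hxB : x ∈ B
    · exact subset_closure (hG.symm.mem hxB)
    · rwa [hG.symm.2.2 x hxB]
  have hgC : Continuous (gradient (ψ ∘ G.symm)) :=
    (InnerProductSpace.toDual ℝ (Eucl n)).symm.continuous.comp
      (hφ.continuous_fderiv (by norm_num))
  have hne : ∀ x ∈ closure (B \ Ω), gradient (ψ ∘ G.symm) x ≠ 0 := by
    intro x hx h0
    have hxB : x ∈ closure B := closure_mono diff_subset hx
    have hxΩ : x ∉ Ω := by
      intro h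
      obtain ⟨w, hw1, hw2⟩ := mem_closure_iff.1 hx Ω hΩop h
      exact hw2.2 hw1
    have h1 : fderiv ℝ (ψ ∘ G.symm) x = 0 := by
      rw [gradient, map_eq_zero_iff _ (LinearIsometryEquiv.injective _)] at h0
      exact h0
    have h2 : ψ = (ψ ∘ G.symm) ∘ G := by ext z; simp
    have h3 : gradient ψ (G.symm x) = 0 := by
      rw [gradient, map_eq_zero_iff _ (LinearIsometryEquiv.injective _)]
      conv_lhs => rw [h2]
      rw [fderiv_comp _ (hφ.differentiable (by norm_num) _) (hG.1.differentiable (by norm_num) _),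
        Equiv.apply_symm_apply, h1, ContinuousLinearMap.zero_comp]
    have := hGS (G.symm x) ⟨hcl x hxB, h3⟩
    rw [Equiv.apply_symm_apply] at this
    exact hxΩ this
  refine ⟨univ, ψ ∘ G.symm, isOpen_univ, subset_univ _, hφ.contDiffOn,
    fun x hx => hpos _ (hG.symm.mem hx), fun x hx => ?_, ?_⟩
  · rw [Function.comp_apply, hG.symm.2.2 x (hfrx x hx)]
    exact hzero x hx
  · have hcomp : IsCompact (closure (B \ Ω)) := (hBbdd.subset diff_subset).isCompact_closure
    rcases (closure (B \ Ω)).eq_empty_or_nonempty with he | hn'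
    · exact ⟨1, one_pos, by simp [he]⟩
    · obtain ⟨x, hx, hmin⟩ := hcomp.exists_isMinOn hn' hgC.norm.continuousOn
      exact ⟨‖gradient (ψ ∘ G.symm) x‖, norm_pos_iff.2 (hne x hx), fun y hy => hmin hy⟩
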